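/- Let φ : ℝⁿ → ℝ ∪ {+∞} be proper and lower semicontinuous. Then φ is convex if and only if there exists ρ ≥ 0 such that φ is ρ-weakly convex and, for every (x,y) ∈ gph ∂φ and every w, z ∈ ℝⁿ with (z, −w) ∈ N_{gph ∂φ}(x,y), one has ⟨z,w⟩ ≥ 0. -/

import Mathlib

open scoped RealInnerProductSpace
open Filter Topology MeasureTheory Set

noncomputable section

variable {n : ℕ}

/-- Convexity of an extended-real-valued function `φ : ℝⁿ → ℝ ∪ {+∞}`. -/
def ERealConvex {F : Type*} [AddCommGroup F] [Module ℝ F] (φ : F → EReal) : Prop :=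
  ∀ x y : F, ∀ a b : ℝ, 0 ≤ a → 0 ≤ b → a + b = 1 →
    φ (a • x + b • y) ≤ (a : EReal) * φ x + (b : EReal) * φ y

/-- The shifted function `x ↦ φ(x) + (ρ/2)‖x‖²`. -/
def shiftFun (ρ : ℝ) (φ : EuclideanSpace ℝ (Fin n) → EReal) :
    EuclideanSpace ℝ (Fin n) → EReal :=
  fun x => φ x + (((ρ / 2) * ‖x‖ ^ 2 : ℝ) : EReal)

/-- The subdifferential of a `ρ`-weakly convex function. -/
def subdiff (ρ : ℝ) (φ : EuclideanSpace ℝ (Fin n) → EReal)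
    (x : EuclideanSpace ℝ (Fin n)) : Set (EuclideanSpace ℝ (Fin n)) :=
  {v | φ x ≠ ⊤ ∧
    ∀ u, φ x + ((⟪v, u - x⟫ - (ρ / 2) * ‖u - x‖ ^ 2 : ℝ) : EReal) ≤ φ u}

/-- Graph of the subdifferential mapping. -/
def gphSubdiff (ρ : ℝ) (φ : EuclideanSpace ℝ (Fin n) → EReal) :
    Set (EuclideanSpace ℝ (Fin n) × EuclideanSpace ℝ (Fin n)) :=
  {p | p.2 ∈ subdiff ρ φ p.1}

/-- The (Bouligand–Severi) tangent/contingent cone to `S` at `z`. -/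
def contTangentCone {F : Type*} [NormedAddCommGroup F] [NormedSpace ℝ F]
    (S : Set F) (z : F) : Set F :=
  {w | ∃ (t : ℕ → ℝ) (ws : ℕ → F), (∀ k, 0 < t k) ∧ Tendsto t atTop (𝓝 0) ∧
    Tendsto ws atTop (𝓝 w) ∧ ∀ k, z + t k • ws k ∈ S}

/-- Inner product of pairs in `ℝⁿ × ℝⁿ`. -/
def pairInner (p q : EuclideanSpace ℝ (Fin n) × EuclideanSpace ℝ (Fin n)) : ℝ :=
  ⟪p.1, q.1⟫ + ⟪p.2, q.2⟫

/-- The (Fréchet) regular normal cone to `S` at `z`. -/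
def regNormalCone (S : Set (EuclideanSpace ℝ (Fin n) × EuclideanSpace ℝ (Fin n)))
    (z : EuclideanSpace ℝ (Fin n) × EuclideanSpace ℝ (Fin n)) :
    Set (EuclideanSpace ℝ (Fin n) × EuclideanSpace ℝ (Fin n)) :=
  {v | ∀ ε > (0 : ℝ), ∃ δ > (0 : ℝ), ∀ u ∈ S, ‖u - z‖ < δ →
      pairInner v (u - z) ≤ ε * ‖u - z‖}

/-- The (Mordukhovich) limiting normal cone to `S` at `z`. -/
def limNormalCone (S : Set (EuclideanSpace ℝ (Fin n) × EuclideanSpace ℝ (Fin n)))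
    (z : EuclideanSpace ℝ (Fin n) × EuclideanSpace ℝ (Fin n)) :
    Set (EuclideanSpace ℝ (Fin n) × EuclideanSpace ℝ (Fin n)) :=
  {v | ∃ zs vs : ℕ → EuclideanSpace ℝ (Fin n) × EuclideanSpace ℝ (Fin n),
    (∀ k, zs k ∈ S) ∧ Tendsto zs atTop (𝓝 z) ∧ Tendsto vs atTop (𝓝 v) ∧
    ∀ k, vs k ∈ regNormalCone S (zs k)}

/-- The Moreau envelope `e_λ φ`. -/
def moreau (lam : ℝ) (φ : EuclideanSpace ℝ (Fin n) → EReal)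
    (x : EuclideanSpace ℝ (Fin n)) : EReal :=
  ⨅ y, (φ y + ((‖y - x‖ ^ 2 / (2 * lam) : ℝ) : EReal))

/-- Second-order difference quotient `Δ²_τ φ(x,v)(u)`. -/
def delta2 (φ : EuclideanSpace ℝ (Fin n) → EReal) (x v : EuclideanSpace ℝ (Fin n))
    (τ : ℝ) (u : EuclideanSpace ℝ (Fin n)) : EReal :=
  ((2 / τ ^ 2 : ℝ) : EReal) * (φ (x + τ • u) - φ x - ((τ * ⟪v, u⟫ : ℝ) : EReal))

/-- The second subderivative `d²φ(x,v)(w)`. -/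
def secondSubderiv (φ : EuclideanSpace ℝ (Fin n) → EReal)
    (x v w : EuclideanSpace ℝ (Fin n)) : EReal :=
  Filter.liminf (fun p : ℝ × EuclideanSpace ℝ (Fin n) => delta2 φ x v p.1 p.2)
    ((𝓝[>] (0 : ℝ)) ×ˢ 𝓝 w)

/-- Twice epi-differentiability of `φ` at `x` for `v`. -/
def TwiceEpiDiff (φ : EuclideanSpace ℝ (Fin n) → EReal)
    (x v : EuclideanSpace ℝ (Fin n)) : Prop :=
  ∀ w : EuclideanSpace ℝ (Fin n), ∀ τ : ℕ → ℝ, (∀ k, 0 < τ k) →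
    Tendsto τ atTop (𝓝 0) →
    ∃ ws : ℕ → EuclideanSpace ℝ (Fin n), Tendsto ws atTop (𝓝 w) ∧
      Tendsto (fun k => delta2 φ x v (τ k) (ws k)) atTop (𝓝 (secondSubderiv φ x v w))

/-- Generalized twice differentiability of `φ` at `x` for `v`. -/
def GenTwiceDiff (φ : EuclideanSpace ℝ (Fin n) → EReal)
    (x v : EuclideanSpace ℝ (Fin n)) : Prop :=
  TwiceEpiDiff φ x v ∧
    ∃ (A : EuclideanSpace ℝ (Fin n) →ₗ[ℝ] EuclideanSpace ℝ (Fin n))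
      (L : Submodule ℝ (EuclideanSpace ℝ (Fin n))),
      (∀ u w, ⟪A u, w⟫ = ⟪u, A w⟫) ∧
      (∀ w ∈ L, secondSubderiv φ x v w = ((⟪w, A w⟫ : ℝ) : EReal)) ∧
      (∀ w ∉ L, secondSubderiv φ x v w = (⊤ : EReal))


section Helpers

/-- Real-valued form of weak convexity. -/
def WCReal (ρ : ℝ) (φ : (EuclideanSpace ℝ (Fin n)) → EReal) : Prop :=
  ∀ x y : (EuclideanSpace ℝ (Fin n)), φ x ≠ ⊤ → φ y ≠ ⊤ → ∀ a b : ℝ, 0 ≤ a → 0 ≤ b → a + b = 1 →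
    φ (a • x + b • y) ≠ ⊤ ∧
    (φ (a • x + b • y)).toReal ≤ a * (φ x).toReal + b * (φ y).toReal
      + ρ / 2 * (a * b * ‖x - y‖ ^ 2)

lemma normsq_comb (x y : (EuclideanSpace ℝ (Fin n))) (a b : ℝ) (hab : a + b = 1) :
    ‖a • x + b • y‖ ^ 2 = a * ‖x‖ ^ 2 + b * ‖y‖ ^ 2 - a * b * ‖x - y‖ ^ 2 := by
  rw [norm_add_sq_real, norm_sub_sq_real, norm_smul, norm_smul, inner_smul_left, inner_smul_right,
    mul_pow, mul_pow, Real.norm_eq_abs, Real.norm_eq_abs, sq_abs, sq_abs]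
  obtain rfl : b = 1 - a := by linarith
  simp only [conj_trivial]
  ring

lemma wcReal_of (ρ : ℝ) (φ : (EuclideanSpace ℝ (Fin n)) → EReal) (hb : ∀ x, φ x ≠ ⊥)
    (h : ERealConvex (shiftFun ρ φ)) : WCReal ρ φ := by
  intro x y hx hy a b ha hb' hab
  have h1 := h x y a b ha hb' hab
  unfold shiftFun at h1
  have ex := EReal.coe_toReal hx (hb x)
  have ey := EReal.coe_toReal hy (hb y)
  rw [← ex, ← ey, ← EReal.coe_add, ← EReal.coe_add, ← EReal.coe_mul, ← EReal.coe_mul,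
    ← EReal.coe_add] at h1
  have hc : φ (a • x + b • y) ≠ ⊤ := by
    intro hc
    rw [hc, EReal.top_add_coe] at h1
    exact absurd (lt_of_le_of_lt h1 (EReal.coe_lt_top _)) (lt_irrefl _)
  refine ⟨hc, ?_⟩
  rw [← EReal.coe_toReal hc (hb _), ← EReal.coe_add, EReal.coe_le_coe_iff,
    normsq_comb x y a b hab] at h1
  linarith

lemma mem_gph_iff (ρ : ℝ) (φ : (EuclideanSpace ℝ (Fin n)) → EReal) (hb : ∀ x, φ x ≠ ⊥) (x v : (EuclideanSpace ℝ (Fin n))) :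
    (x, v) ∈ gphSubdiff ρ φ ↔ φ x ≠ ⊤ ∧ ∀ u, φ u ≠ ⊤ →
      (φ x).toReal + ⟪v, u - x⟫ - ρ / 2 * ‖u - x‖ ^ 2 ≤ (φ u).toReal := by
  unfold gphSubdiff subdiff
  simp only [mem_ofPred_eq]
  constructor
  · rintro ⟨h1, h2⟩
    refine ⟨h1, fun u hu => ?_⟩
    have := h2 u
    rw [← EReal.coe_toReal h1 (hb x), ← EReal.coe_toReal hu (hb u), ← EReal.coe_add,
      EReal.coe_le_coe_iff] at this
    linarith
  · rintro ⟨h1, h2⟩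
    refine ⟨h1, fun u => ?_⟩
    by_cases hu : φ u = ⊤
    · rw [hu]; exact le_top
    rw [← EReal.coe_toReal h1 (hb x), ← EReal.coe_toReal hu (hb u), ← EReal.coe_add,
      EReal.coe_le_coe_iff]
    linarith [h2 u hu]

lemma growth (ρ : ℝ) (φ : (EuclideanSpace ℝ (Fin n)) → EReal) (hb : ∀ x, φ x ≠ ⊥)
    (hl : LowerSemicontinuous φ) (hw : WCReal ρ φ) (x0 : (EuclideanSpace ℝ (Fin n))) (hx0 : φ x0 ≠ ⊤) (hρ : 0 ≤ ρ) :
    ∃ A : ℝ, 0 ≤ A ∧ ∀ x, φ x ≠ ⊤ →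
      -A - A * ‖x - x0‖ - ρ / 2 * ‖x - x0‖ ^ 2 ≤ (φ x).toReal := by
  obtain ⟨y0, hy0, hmin⟩ := (hl.lowerSemicontinuousOn (Metric.closedBall x0 1)).exists_isMinOn
    ⟨x0, Metric.mem_closedBall_self zero_le_one⟩ (isCompact_closedBall x0 1)
  rw [isMinOn_iff] at hmin
  have hy0t : φ y0 ≠ ⊤ := by
    intro h
    have := hmin x0 (Metric.mem_closedBall_self zero_le_one)
    rw [h, top_le_iff] at this
    exact hx0 this
  have hm : ∀ x, φ x ≠ ⊤ → ‖x - x0‖ ≤ 1 → (φ y0).toReal ≤ (φ x).toReal := by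
    intro x hx hxx
    exact EReal.toReal_le_toReal (hmin x (by rwa [mem_closedBall_iff_norm])) (hb _) hx
  set m := (φ y0).toReal
  set f0 := (φ x0).toReal
  refine ⟨|m| + |f0|, by positivity, fun x hx => ?_⟩
  set r := ‖x - x0‖ with hr
  have hr0 : 0 ≤ r := norm_nonneg _
  have e1 := neg_abs_le m
  have e2 := neg_abs_le f0
  have e3 := le_abs_self m
  have e4 := le_abs_self f0
  have e5 := abs_nonneg m
  have e6 := abs_nonneg f0
  by_cases h1 : r ≤ 1
  · have := hm x hx h1
    have h3 : 0 ≤ ρ / 2 * r ^ 2 := by positivity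
    have h4 : 0 ≤ (|m| + |f0|) * r := by positivity
    linarith
  · push Not at h1
    have hrp : 0 < r := by linarith
    have hi : 0 < r⁻¹ := by positivity
    have hi1 : r⁻¹ ≤ 1 := inv_le_one_of_one_le₀ h1.le
    obtain ⟨hD, hle⟩ := hw x0 x hx0 hx (1 - r⁻¹) r⁻¹ (by linarith) hi.le (by ring)
    have hy : (1 - r⁻¹) • x0 + r⁻¹ • x - x0 = r⁻¹ • (x - x0) := by module
    have hny : ‖(1 - r⁻¹) • x0 + r⁻¹ • x - x0‖ ≤ 1 := by
      rw [hy, norm_smul, ← hr, Real.norm_eq_abs, abs_of_pos hi, inv_mul_cancel₀ hrp.ne']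
    have h2 := (hm _ hD hny).trans hle
    rw [norm_sub_rev x0 x, ← hr] at h2
    have h3 := mul_le_mul_of_nonneg_left h2 hr0
    have h4 : r * ((1 - r⁻¹) * f0 + r⁻¹ * (φ x).toReal + ρ / 2 * ((1 - r⁻¹) * r⁻¹ * r ^ 2))
        = (r - 1) * f0 + (φ x).toReal + ρ / 2 * ((r - 1) * r) := by
      field_simp
    rw [h4] at h3
    have h5 : (r - 1) * f0 ≤ r * |f0| := by nlinarith
    have h6 : -(r * |m|) ≤ r * m := by nlinarith
    have h7 : ρ / 2 * ((r - 1) * r) ≤ ρ / 2 * r ^ 2 := by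
      apply mul_le_mul_of_nonneg_left _ (by linarith)
      nlinarith
    linarith

lemma exists_min (ρ μ : ℝ) (φ : (EuclideanSpace ℝ (Fin n)) → EReal) (hb : ∀ x, φ x ≠ ⊥)
    (hl : LowerSemicontinuous φ) (hw : WCReal ρ φ) (hp : ∃ x, φ x ≠ ⊤) (hρ : 0 ≤ ρ) (hμ : ρ < μ)
    (c : (EuclideanSpace ℝ (Fin n))) : ∃ p, φ p ≠ ⊤ ∧ ∀ x, φ x ≠ ⊤ →
      (φ p).toReal + μ / 2 * ‖p - c‖ ^ 2 ≤ (φ x).toReal + μ / 2 * ‖x - c‖ ^ 2 := by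
  obtain ⟨x0, hx0⟩ := hp
  obtain ⟨A, hA, hg⟩ := growth ρ φ hb hl hw x0 hx0 hρ
  set k := ‖x0 - c‖ with hk
  have hk0 : 0 ≤ k := norm_nonneg _
  set h0 := (φ x0).toReal + μ / 2 * k ^ 2 with hh0
  set δ := (μ - ρ) / 2 with hδ
  have hδp : 0 < δ := by rw [hδ]; linarith
  set R := max 1 ((2 * A + μ * k + |h0| + 1) / δ) with hR
  have hR1 : 1 ≤ R := le_max_left _ _
  have hR2 : (2 * A + μ * k + |h0| + 1) / δ ≤ R := le_max_right _ _
  rw [div_le_iff₀ hδp] at hR2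
  have hout : ∀ x, φ x ≠ ⊤ → R < ‖x - x0‖ → h0 < (φ x).toReal + μ / 2 * ‖x - c‖ ^ 2 := by
    intro x hx hxR
    have h1 := hg x hx
    have h2 : ‖x - x0‖ ≤ ‖x - c‖ + k := by
      have : x - x0 = (x - c) - (x0 - c) := by abel
      rw [this]; exact norm_sub_le _ _
    have h2' : k ≤ ‖x - c‖ + ‖x - x0‖ := by
      have : x0 - c = (x - c) - (x - x0) := by abel
      rw [hk, this]; exact norm_sub_le _ _
    set r := ‖x - x0‖
    set s := ‖x - c‖
    have hs : (r - k) ^ 2 ≤ s ^ 2 := by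
      apply sq_le_sq'
      · linarith
      · linarith
    have h3 : μ / 2 * (r - k) ^ 2 ≤ μ / 2 * s ^ 2 :=
      mul_le_mul_of_nonneg_left hs (by linarith)
    have h4 : (2 * A + μ * k + |h0| + 1) * r ≤ (r * δ) * r := by
      apply mul_le_mul_of_nonneg_right _ (by linarith)
      nlinarith
    have h5 := le_abs_self h0
    have h6 := abs_nonneg h0
    have h7 : (A + |h0| + 1) * 1 ≤ (A + |h0| + 1) * r :=
      mul_le_mul_of_nonneg_left (by linarith) (by linarith)
    have h8 : 0 ≤ μ / 2 * k ^ 2 := by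
      have : 0 ≤ μ := by linarith
      positivity
    have h9 : (r * δ) * r = μ / 2 * r ^ 2 - ρ / 2 * r ^ 2 := by rw [hδ]; ring
    nlinarith
  have hlsc : LowerSemicontinuous (fun x => φ x + ((μ / 2 * ‖x - c‖ ^ 2 : ℝ) : EReal)) := by
    apply LowerSemicontinuous.add' hl
    · apply Continuous.lowerSemicontinuous
      exact continuous_coe_real_ereal.comp (by fun_prop)
    · intro x
      exact EReal.continuousAt_add (Or.inr (EReal.coe_ne_bot _)) (Or.inr (EReal.coe_ne_top _))
  obtain ⟨p, hpm, hmin⟩ := (hlsc.lowerSemicontinuousOn (Metric.closedBall x0 R)).exists_isMinOn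
    ⟨x0, Metric.mem_closedBall_self (by linarith)⟩ (isCompact_closedBall x0 R)
  rw [isMinOn_iff] at hmin
  have hpt : φ p ≠ ⊤ := by
    intro h
    have := hmin x0 (Metric.mem_closedBall_self (by linarith))
    rw [h, ← EReal.coe_toReal hx0 (hb _), EReal.top_add_coe, ← EReal.coe_add, top_le_iff] at this
    exact EReal.coe_ne_top _ this
  have hin : ∀ x, φ x ≠ ⊤ → ‖x - x0‖ ≤ R →
      (φ p).toReal + μ / 2 * ‖p - c‖ ^ 2 ≤ (φ x).toReal + μ / 2 * ‖x - c‖ ^ 2 := by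
    intro x hx hxx
    have := hmin x (by rwa [mem_closedBall_iff_norm])
    rwa [← EReal.coe_toReal hx (hb _), ← EReal.coe_toReal hpt (hb _), ← EReal.coe_add,
      ← EReal.coe_add, EReal.coe_le_coe_iff] at this
  refine ⟨p, hpt, fun x hx => ?_⟩
  by_cases hxx : ‖x - x0‖ ≤ R
  · exact hin x hx hxx
  · push Not at hxx
    have h1 := hin x0 hx0 (by simp; linarith)
    exact h1.trans (hout x hx hxx).le

lemma exists_prox (ρ μ : ℝ) (φ : (EuclideanSpace ℝ (Fin n)) → EReal) (hb : ∀ x, φ x ≠ ⊥)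
    (hl : LowerSemicontinuous φ) (hw : WCReal ρ φ) (hp : ∃ x, φ x ≠ ⊤) (hρ : 0 ≤ ρ) (hμ : ρ < μ) :
    ∃ p : (EuclideanSpace ℝ (Fin n)) → (EuclideanSpace ℝ (Fin n)), ∀ c, (p c, μ • (c - p c)) ∈ gphSubdiff ρ φ := by
  choose p hp1 hp2 using exists_min ρ μ φ hb hl hw hp hρ hμ
  refine ⟨p, fun c => ?_⟩
  rw [mem_gph_iff ρ φ hb]
  refine ⟨hp1 c, fun x hx => ?_⟩
  rw [inner_smul_left]
  simp only [conj_trivial]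
  have hin : ⟪c - p c, x - p c⟫ = - ⟪p c - c, x - p c⟫ := by
    rw [← neg_sub, inner_neg_left]
  rw [hin]
  set S := ‖x - p c‖ ^ 2 with hS
  have hS0 : 0 ≤ S := by positivity
  have key : ∀ t : ℝ, 0 < t → t ≤ 1 → (φ (p c)).toReal ≤ (φ x).toReal + ρ / 2 * ((1 - t) * S)
      + μ * ⟪p c - c, x - p c⟫ + μ / 2 * (t * S) := by
    intro t ht ht1
    obtain ⟨hD, hle⟩ := hw (p c) x (hp1 c) hx (1 - t) t (by linarith) ht.le (by ring)
    have h1 := (hp2 c _ hD)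
    have e : (1 - t) • p c + t • x - c = (p c - c) + t • (x - p c) := by module
    rw [e, norm_add_sq_real, norm_smul, mul_pow, Real.norm_eq_abs, sq_abs, inner_smul_right,
      ← hS] at h1
    rw [norm_sub_rev, ← hS] at hle
    have h2 : t * (φ (p c)).toReal ≤ t * ((φ x).toReal + ρ / 2 * ((1 - t) * S)
      + μ * ⟪p c - c, x - p c⟫ + μ / 2 * (t * S)) := by nlinarith
    exact le_of_mul_le_mul_left h2 ht
  have hlim : (φ (p c)).toReal ≤ (φ x).toReal + ρ / 2 * S + μ * ⟪p c - c, x - p c⟫ := by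
    apply le_of_forall_pos_le_add
    intro ε hε
    have hμ0 : 0 < μ := by linarith
    have hpos : 0 < μ * S + 1 := by positivity
    set t := min 1 (ε / (μ * S + 1)) with ht
    have ht0 : 0 < t := lt_min one_pos (by positivity)
    have hk := key t ht0 (min_le_left _ _)
    have ht2 : t ≤ ε / (μ * S + 1) := min_le_right _ _
    rw [le_div_iff₀ hpos] at ht2
    have h3 : 0 ≤ ρ / 2 * (t * S) := by positivity
    have h4 : 0 ≤ μ * S * t := by positivity
    nlinarith
  linarith

lemma hypomono (ρ : ℝ) (φ : (EuclideanSpace ℝ (Fin n)) → EReal) (hb : ∀ x, φ x ≠ ⊥) (x v x' v' : (EuclideanSpace ℝ (Fin n)))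
    (h : (x, v) ∈ gphSubdiff ρ φ) (h' : (x', v') ∈ gphSubdiff ρ φ) :
    -(ρ * ‖x - x'‖ ^ 2) ≤ ⟪x - x', v - v'⟫ := by
  rw [mem_gph_iff ρ φ hb] at h h'
  have h1 := h.2 x' h'.1
  have h2 := h'.2 x h.1
  have e1 : ⟪v, x' - x⟫ = - ⟪x - x', v⟫ := by
    rw [real_inner_comm, ← neg_sub, inner_neg_left]
  rw [e1, norm_sub_rev] at h1
  rw [real_inner_comm] at h2
  rw [inner_sub_right]
  linarith

lemma prox_eq (ρ μ : ℝ) (φ : (EuclideanSpace ℝ (Fin n)) → EReal) (hb : ∀ x, φ x ≠ ⊥) (hρ : 0 ≤ ρ) (hμ : ρ < μ)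
    (p : (EuclideanSpace ℝ (Fin n)) → (EuclideanSpace ℝ (Fin n))) (hp : ∀ c, (p c, μ • (c - p c)) ∈ gphSubdiff ρ φ) (x v : (EuclideanSpace ℝ (Fin n)))
    (h : (x, v) ∈ gphSubdiff ρ φ) : ∃ c, x = p c ∧ v = μ • (c - p c) := by
  have hμ0 : μ ≠ 0 := by linarith
  set c := x + μ⁻¹ • v with hc
  have hv : v = μ • (c - x) := by
    rw [hc, add_sub_cancel_left, smul_smul, mul_inv_cancel₀ hμ0, one_smul]
  have h1 := hypomono ρ φ hb _ _ _ _ h (hp c)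
  have e : v - μ • (c - p c) = (-μ) • (x - p c) := by rw [hv]; module
  rw [e, inner_smul_right, real_inner_self_eq_norm_sq] at h1
  have h2 : ‖x - p c‖ ^ 2 ≤ 0 := by
    have := sq_nonneg ‖x - p c‖
    nlinarith
  have h3 : ‖x - p c‖ = 0 := by
    have := sq_nonneg ‖x - p c‖
    exact pow_eq_zero_iff (two_ne_zero) |>.1 (le_antisymm h2 this)
  have h4 : x = p c := by rwa [norm_eq_zero, sub_eq_zero] at h3
  exact ⟨c, h4, by rw [← h4]; exact hv⟩

lemma prox_cocoercive (ρ μ : ℝ) (φ : (EuclideanSpace ℝ (Fin n)) → EReal) (hb : ∀ x, φ x ≠ ⊥)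
    (p : (EuclideanSpace ℝ (Fin n)) → (EuclideanSpace ℝ (Fin n))) (hp : ∀ c, (p c, μ • (c - p c)) ∈ gphSubdiff ρ φ) (c c' : (EuclideanSpace ℝ (Fin n))) :
    (μ - ρ) * ‖p c - p c'‖ ^ 2 ≤ μ * ⟪p c - p c', c - c'⟫ := by
  have h1 := hypomono ρ φ hb _ _ _ _ (hp c) (hp c')
  have e : μ • (c - p c) - μ • (c' - p c') = μ • ((c - c') - (p c - p c')) := by module
  rw [e, inner_smul_right, inner_sub_right, real_inner_self_eq_norm_sq] at h1
  linarith

lemma prox_lip (ρ μ : ℝ) (φ : (EuclideanSpace ℝ (Fin n)) → EReal) (hb : ∀ x, φ x ≠ ⊥) (hρ : 0 ≤ ρ) (hμ : ρ < μ)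
    (p : (EuclideanSpace ℝ (Fin n)) → (EuclideanSpace ℝ (Fin n))) (hp : ∀ c, (p c, μ • (c - p c)) ∈ gphSubdiff ρ φ) (c c' : (EuclideanSpace ℝ (Fin n))) :
    ‖p c - p c'‖ ≤ μ / (μ - ρ) * ‖c - c'‖ := by
  have h1 := prox_cocoercive ρ μ φ hb p hp c c'
  have h2 := real_inner_le_norm (p c - p c') (c - c')
  have hd : 0 < μ - ρ := by linarith
  rw [div_mul_eq_mul_div, le_div_iff₀ hd]
  rcases (norm_nonneg (p c - p c')).eq_or_lt with h0 | h0
  · rw [← h0, zero_mul]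
    exact mul_nonneg (by linarith) (norm_nonneg _)
  · have h3 : μ * ⟪p c - p c', c - c'⟫ ≤ μ * (‖p c - p c'‖ * ‖c - c'‖) :=
      mul_le_mul_of_nonneg_left h2 (by linarith)
    apply le_of_mul_le_mul_left _ h0
    nlinarith

lemma reg_nonneg (φ : (EuclideanSpace ℝ (Fin n)) → EReal) (hb : ∀ x, φ x ≠ ⊥)
    (p : (EuclideanSpace ℝ (Fin n)) → (EuclideanSpace ℝ (Fin n))) (hp : ∀ c, (p c, (1 : ℝ) • (c - p c)) ∈ gphSubdiff 0 φ)
    (q : (EuclideanSpace ℝ (Fin n)) × (EuclideanSpace ℝ (Fin n))) (hq : q ∈ gphSubdiff 0 φ) (z w : (EuclideanSpace ℝ (Fin n)))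
    (h : (z, w) ∈ regNormalCone (gphSubdiff 0 φ) q) : 0 ≤ ⟪z, -w⟫ := by
  obtain ⟨w, rfl⟩ : ∃ w', w = -w' := ⟨-w, by simp⟩
  rw [neg_neg]
  obtain ⟨x, y⟩ := q
  obtain ⟨c, rfl, rfl⟩ := prox_eq 0 1 φ hb le_rfl one_pos p hp x y hq
  suffices hD : ‖z - w‖ ≤ ‖z + w‖ by
    have := pow_le_pow_left₀ (norm_nonneg _) hD 2
    rw [norm_add_sq_real, norm_sub_sq_real] at this
    linarith
  rcases (norm_nonneg (z - w)).eq_or_lt with h0 | h0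
  · rw [← h0]; exact norm_nonneg _
  apply le_of_forall_pos_le_add
  intro ε hε
  obtain ⟨δ, hδ, hcone⟩ := h (ε / 2) (by positivity)
  set t := δ / (2 * ‖z - w‖) with ht
  have ht0 : 0 < t := by positivity
  have htD : t * ‖z - w‖ = δ / 2 := by rw [ht]; field_simp
  set d := t • (z - w) with hd
  have hdn : ‖d‖ = t * ‖z - w‖ := by rw [hd, norm_smul, Real.norm_eq_abs, abs_of_pos ht0]
  set Δ := p (c + d) - p c with hΔ
  have hco := prox_cocoercive 0 1 φ hb p hp (c + d) c
  rw [add_sub_cancel_left, ← hΔ] at hco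
  have hn1 : ‖d - Δ‖ ^ 2 ≤ ‖d‖ ^ 2 := by
    rw [norm_sub_sq_real, real_inner_comm]; nlinarith [sq_nonneg ‖Δ‖]
  have hn2 : ‖Δ‖ ^ 2 ≤ ‖d‖ ^ 2 := by
    have := sq_nonneg ‖d - Δ‖
    rw [norm_sub_sq_real, real_inner_comm] at this; nlinarith
  have hn3 : ‖(2 : ℝ) • Δ - d‖ ^ 2 ≤ ‖d‖ ^ 2 := by
    rw [norm_sub_sq_real, norm_smul, inner_smul_left, mul_pow]
    simp only [conj_trivial, Real.norm_ofNat]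
    linarith
  have hn1 := (pow_le_pow_iff_left₀ (norm_nonneg _) (norm_nonneg d) two_ne_zero).1 hn1
  have hn2 := (pow_le_pow_iff_left₀ (norm_nonneg _) (norm_nonneg d) two_ne_zero).1 hn2
  have hn3 := (pow_le_pow_iff_left₀ (norm_nonneg _) (norm_nonneg d) two_ne_zero).1 hn3
  have he : (p (c + d), (1 : ℝ) • (c + d - p (c + d))) - (p c, (1 : ℝ) • (c - p c))
      = (Δ, d - Δ) := by
    ext1
    · rfl
    · simp only [Prod.snd_sub, hΔ]; module
  have hn : ‖((Δ, d - Δ) : (EuclideanSpace ℝ (Fin n)) × (EuclideanSpace ℝ (Fin n)))‖ ≤ ‖d‖ := by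
    rw [Prod.norm_def]; exact max_le hn2 hn1
  have h1 := hcone _ (hp (c + d)) (by rw [he]; linarith)
  rw [he] at h1
  have h2 : pairInner (z, -w) (Δ, d - Δ) ≤ ε / 2 * ‖d‖ :=
    h1.trans (mul_le_mul_of_nonneg_left hn (by positivity))
  have h3 : 2 * pairInner (z, -w) (Δ, d - Δ) = ⟪z - w, d⟫ + ⟪z + w, (2 : ℝ) • Δ - d⟫ := by
    unfold pairInner
    simp only [inner_sub_right, inner_sub_left, inner_add_left, inner_neg_left, inner_smul_right]
    ring
  have h4 : ⟪z - w, d⟫ = t * ‖z - w‖ ^ 2 := by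
    rw [hd, inner_smul_right, real_inner_self_eq_norm_sq]
  have h5 := neg_le_of_abs_le (abs_real_inner_le_norm (z + w) ((2 : ℝ) • Δ - d))
  have h6 : ‖z + w‖ * ‖(2 : ℝ) • Δ - d‖ ≤ ‖z + w‖ * ‖d‖ :=
    mul_le_mul_of_nonneg_left hn3 (norm_nonneg _)
  have h7 : (t * ‖z - w‖) * ‖z - w‖ ≤ (t * ‖z - w‖) * (‖z + w‖ + ε) := by
    rw [hdn] at h6 h2
    nlinarith
  exact le_of_mul_le_mul_left h7 (by positivity)

lemma lim_nonneg (φ : (EuclideanSpace ℝ (Fin n)) → EReal) (hb : ∀ x, φ x ≠ ⊥)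
    (p : (EuclideanSpace ℝ (Fin n)) → (EuclideanSpace ℝ (Fin n))) (hp : ∀ c, (p c, (1 : ℝ) • (c - p c)) ∈ gphSubdiff 0 φ)
    (q : (EuclideanSpace ℝ (Fin n)) × (EuclideanSpace ℝ (Fin n))) (z w : (EuclideanSpace ℝ (Fin n)))
    (h : (z, -w) ∈ limNormalCone (gphSubdiff 0 φ) q) : 0 ≤ ⟪z, w⟫ := by
  obtain ⟨zs, vs, h1, -, h3, h4⟩ := h
  have hc : Continuous (fun v : (EuclideanSpace ℝ (Fin n)) × (EuclideanSpace ℝ (Fin n)) => ⟪v.1, -v.2⟫) := by fun_prop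
  have := (hc.tendsto _).comp h3
  simp only [neg_neg] at this
  refine ge_of_tendsto' this fun k => ?_
  exact reg_nonneg φ hb p hp (zs k) (h1 k) _ _ (h4 k)

lemma lip_of_ae (F : (EuclideanSpace ℝ (Fin n)) → (EuclideanSpace ℝ (Fin n))) (K : NNReal) (hF : LipschitzWith K F)
    (h : ∀ᵐ x : (EuclideanSpace ℝ (Fin n)), ∀ d e : (EuclideanSpace ℝ (Fin n)), ⟪fderiv ℝ F x d, e⟫ ≤ ‖d‖ * ‖e‖) (x d e : (EuclideanSpace ℝ (Fin n))) :
    ⟪F (x + d) - F x, e⟫ ≤ ‖d‖ * ‖e‖ := by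
  have hFc := hF.continuous
  by_contra hcon
  push Not at hcon
  have hcont : Continuous (fun y : (EuclideanSpace ℝ (Fin n)) => ⟪F (y + d) - F y, e⟫) := by fun_prop
  obtain ⟨r, hr, hball⟩ := Metric.eventually_nhds_iff_ball.1
    (hcont.continuousAt.eventually (lt_mem_nhds hcon) : ∀ᶠ y in 𝓝 x, _)
  set B := Metric.ball x r with hB
  set ν := (volume : Measure (EuclideanSpace ℝ (Fin n))).restrict B with hν
  have hfin : IsFiniteMeasure ν := ⟨by
    rw [hν, Measure.restrict_apply_univ]; exact Metric.isBounded_ball.measure_lt_top⟩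
  have hint : ∀ g : (EuclideanSpace ℝ (Fin n)) → ℝ, Continuous g → Integrable g ν := by
    intro g hg
    have : IntegrableOn g (Metric.closedBall x r) volume :=
      hg.continuousOn.integrableOn_compact (isCompact_closedBall x r)
    exact this.mono_set Metric.ball_subset_closedBall
  set G : ℝ → ℝ := fun t => ∫ y, ⟪F (y + t • d), e⟫ ∂ν with hG
  have hae : ∀ t : ℝ, ∀ᵐ y : (EuclideanSpace ℝ (Fin n)), DifferentiableAt ℝ F (y + t • d) ∧
      ∀ d₁ e₁ : (EuclideanSpace ℝ (Fin n)), ⟪fderiv ℝ F (y + t • d) d₁, e₁⟫ ≤ ‖d₁‖ * ‖e₁‖ := by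
    intro t
    have := hF.ae_differentiableAt (μ := (volume : Measure (EuclideanSpace ℝ (Fin n))))
    have key := (measurePreserving_add_right (volume : Measure (EuclideanSpace ℝ (Fin n)))
      (t • d)).quasiMeasurePreserving.ae (this.and h)
    refine key.mono fun y hy => ?_
    exact hy
  have hder : ∀ t : ℝ, HasDerivAt G (∫ y, ⟪fderiv ℝ F (y + t • d) d, e⟫ ∂ν) t ∧
      Integrable (fun y => ⟪fderiv ℝ F (y + t • d) d, e⟫) ν := by
    intro t
    refine And.symm (hasDerivAt_integral_of_dominated_loc_of_lip (s := univ)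
      (bound := fun _ => K * ‖d‖ * ‖e‖)
      (F := fun t y => ⟪F (y + t • d), e⟫) (Filter.univ_mem) ?_ ?_ ?_ ?_ ?_ ?_)
    · exact Eventually.of_forall fun s => (hint _ (by fun_prop)).aestronglyMeasurable
    · exact hint _ (by fun_prop)
    · have hm : Measurable (fun y => fderiv ℝ F (y + t • d) d) :=
        (measurable_fderiv_apply_const ℝ F d).comp (measurable_add_const (t • d))
      exact (hm.inner measurable_const).aestronglyMeasurable
    · refine Eventually.of_forall fun y => LipschitzOnWith.of_dist_le_mul fun s _ s' _ => ?_
      rw [Real.dist_eq, ← inner_sub_left, Real.coe_nnabs,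
        abs_of_nonneg (show 0 ≤ (K : ℝ) * ‖d‖ * ‖e‖ by positivity)]
      refine (abs_real_inner_le_norm _ _).trans ?_
      have h1 := hF.dist_le_mul (y + s • d) (y + s' • d)
      rw [dist_eq_norm, dist_eq_norm] at h1
      have h2 : y + s • d - (y + s' • d) = (s - s') • d := by module
      rw [h2, norm_smul] at h1
      rw [Real.dist_eq, ← Real.norm_eq_abs]
      calc _ ≤ (K * (‖s - s'‖ * ‖d‖)) * ‖e‖ := mul_le_mul_of_nonneg_right h1 (norm_nonneg _)
        _ = _ := by ring
    · exact integrable_const _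
    · refine ae_restrict_of_ae ((hae t).mono fun y hy => ?_)
      have h1 : HasDerivAt (fun s : ℝ => y + s • d) d t := by
        simpa using ((hasDerivAt_id t).smul_const d).const_add y
      have h2 := hy.1.hasFDerivAt.comp_hasDerivAt t h1
      have h3 := h2.inner ℝ (hasDerivAt_const t e)
      simpa using h3
  have hle : ∀ t, deriv G t ≤ ‖d‖ * ‖e‖ * ν.real univ := by
    intro t
    rw [(hder t).1.deriv]
    calc _ ≤ ∫ y, ‖d‖ * ‖e‖ ∂ν := by
          apply integral_mono_ae (hder t).2 (integrable_const _)
          exact ae_restrict_of_ae ((hae t).mono fun y hy => hy.2 d e)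
      _ = _ := by simp [mul_comm]
  have hmv := (convex_univ : Convex ℝ (univ : Set ℝ)).image_sub_le_mul_sub_of_deriv_le (f := G)
    (fun t _ => (hder t).1.continuousAt.continuousWithinAt)
    (fun t _ => (hder t).1.differentiableAt.differentiableWithinAt)
    (C := ‖d‖ * ‖e‖ * ν.real univ) (fun t _ => hle t) 0 (mem_univ _) 1 (mem_univ _) zero_le_one
  have hsub : G 1 - G 0 = ∫ y, ⟪F (y + d) - F y, e⟫ ∂ν := by
    simp only [hG, one_smul, zero_smul, add_zero, inner_sub_left]
    rw [integral_sub (hint _ (by fun_prop)) (hint _ (by fun_prop))]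
  rw [hsub, sub_zero, mul_one] at hmv
  have hlt : ∫ y, ‖d‖ * ‖e‖ ∂ν < ∫ y, ⟪F (y + d) - F y, e⟫ ∂ν := by
    rw [← sub_pos, ← integral_sub (hint _ hcont) (integrable_const _)]
    rw [hν, setIntegral_pos_iff_support_of_nonneg_ae]
    · refine lt_of_lt_of_le (Metric.measure_ball_pos volume x hr) (measure_mono ?_)
      intro y hy
      exact ⟨(sub_pos.2 (hball y hy)).ne', hy⟩
    · refine (ae_restrict_mem measurableSet_ball).mono fun y hy => ?_
      exact (sub_pos.2 (hball y hy)).le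
    · exact (hint _ hcont).sub (integrable_const _)
  rw [integral_const, smul_eq_mul] at hlt
  linarith

lemma prox_firm (ρ μ : ℝ) (φ : (EuclideanSpace ℝ (Fin n)) → EReal) (hb : ∀ x, φ x ≠ ⊥) (hρ : 0 ≤ ρ) (hμ : ρ < μ)
    (p : (EuclideanSpace ℝ (Fin n)) → (EuclideanSpace ℝ (Fin n))) (hp : ∀ c, (p c, μ • (c - p c)) ∈ gphSubdiff ρ φ)
    (hN : ∀ x y : (EuclideanSpace ℝ (Fin n)), (x, y) ∈ gphSubdiff ρ φ → ∀ w z : (EuclideanSpace ℝ (Fin n)),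
      (z, -w) ∈ limNormalCone (gphSubdiff ρ φ) (x, y) → 0 ≤ ⟪z, w⟫) (c c' : (EuclideanSpace ℝ (Fin n))) :
    ‖p c - p c'‖ ^ 2 ≤ ⟪p c - p c', c - c'⟫ := by
  have hμ0 : 0 < μ := by linarith
  have hK0 : 0 ≤ μ / (μ - ρ) := div_nonneg hμ0.le (by linarith)
  obtain ⟨L, hL⟩ : ∃ L : NNReal, (L : ℝ) = μ / (μ - ρ) := ⟨⟨_, hK0⟩, rfl⟩
  have hlip : LipschitzWith L p := by
    refine LipschitzWith.of_dist_le_mul fun a b => ?_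
    rw [dist_eq_norm, dist_eq_norm, hL]
    exact prox_lip ρ μ φ hb hρ hμ p hp a b
  have hlipF : LipschitzWith (2 * L + 1) (fun c => (2 : ℝ) • p c - c) := by
    refine LipschitzWith.of_dist_le_mul fun a b => ?_
    have h1 := hlip.dist_le_mul a b
    rw [dist_eq_norm, dist_eq_norm] at *
    have e : (2 : ℝ) • p a - a - ((2 : ℝ) • p b - b) = (2 : ℝ) • (p a - p b) - (a - b) := by module
    rw [e]
    refine (norm_sub_le _ _).trans ?_
    rw [norm_smul, Real.norm_ofNat, NNReal.coe_add, NNReal.coe_mul, NNReal.coe_ofNat,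
      NNReal.coe_one]
    linarith
  -- pointwise derivative bound
  have hpt : ∀ c : (EuclideanSpace ℝ (Fin n)), DifferentiableAt ℝ p c → ∀ d e : (EuclideanSpace ℝ (Fin n)),
      ⟪fderiv ℝ (fun c => (2 : ℝ) • p c - c) c d, e⟫ ≤ ‖d‖ * ‖e‖ := by
    intro c hc d e
    set P := fderiv ℝ p c with hP
    have hfd : HasFDerivAt (fun c => (2 : ℝ) • p c - c) ((2 : ℝ) • P - ContinuousLinearMap.id ℝ (EuclideanSpace ℝ (Fin n))) c :=
      (hc.hasFDerivAt.const_smul (2 : ℝ)).sub (hasFDerivAt_id c)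
    rw [hfd.fderiv]
    set Q := ContinuousLinearMap.adjoint P e with hQ
    have hadj : ∀ a, ⟪Q, a⟫ = ⟪e, P a⟫ := fun a => ContinuousLinearMap.adjoint_inner_left P a e
    have hreg : (e - Q, -(μ⁻¹ • Q)) ∈ regNormalCone (gphSubdiff ρ φ) (p c, μ • (c - p c)) := by
      intro ε hε
      set M := ‖e‖ * (1 + μ⁻¹) + 1 with hM
      have hM0 : 0 < M := by positivity
      have hlit := hc.hasFDerivAt.isLittleO.def (show 0 < ε / M by positivity)
      obtain ⟨δ, hδ, hδ'⟩ := Metric.eventually_nhds_iff.1 hlit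
      refine ⟨δ / (1 + μ⁻¹), by positivity, ?_⟩
      rintro ⟨x, v⟩ hu hlt
      obtain ⟨c', rfl, rfl⟩ := prox_eq ρ μ φ hb hρ hμ p hp x v hu
      set Δ := p c' - p c with hΔ
      have he : (p c', μ • (c' - p c')) - (p c, μ • (c - p c)) = (Δ, μ • ((c' - c) - Δ)) := by
        ext1
        · rfl
        · simp only [Prod.snd_sub, hΔ]; module
      rw [he] at hlt ⊢
      set s := ‖((Δ, μ • ((c' - c) - Δ)) : (EuclideanSpace ℝ (Fin n)) × (EuclideanSpace ℝ (Fin n)))‖ with hs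
      have hs1 : ‖Δ‖ ≤ s := norm_fst_le ((Δ, μ • ((c' - c) - Δ)) : (EuclideanSpace ℝ (Fin n)) × (EuclideanSpace ℝ (Fin n)))
      have hs2 : ‖μ • ((c' - c) - Δ)‖ ≤ s := norm_snd_le ((Δ, μ • ((c' - c) - Δ)) : (EuclideanSpace ℝ (Fin n)) × (EuclideanSpace ℝ (Fin n)))
      rw [norm_smul, Real.norm_eq_abs, abs_of_pos hμ0] at hs2
      have hs3 : ‖(c' - c) - Δ‖ ≤ μ⁻¹ * s := by
        rw [inv_mul_eq_div, le_div_iff₀ hμ0]; linarith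
      have hd : ‖c' - c‖ ≤ (1 + μ⁻¹) * s := by
        have : c' - c = Δ + ((c' - c) - Δ) := by abel
        rw [this]
        refine (norm_add_le _ _).trans ?_
        linarith
      have hdδ : dist c' c < δ := by
        rw [dist_eq_norm]
        rw [lt_div_iff₀ (by positivity)] at hlt
        linarith
      have h1 := hδ' hdδ
      have h2 : pairInner (e - Q, -(μ⁻¹ • Q)) (Δ, μ • ((c' - c) - Δ))
          = ⟪e, p c' - p c - P (c' - c)⟫ := by
        unfold pairInner
        simp only [inner_neg_left, inner_smul_left, inner_smul_right, conj_trivial]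
        rw [mul_neg, ← mul_assoc, mul_inv_cancel₀ hμ0.ne', one_mul, inner_sub_left, inner_sub_right Q (c' - c) Δ,
          hadj (c' - c), ← hΔ, inner_sub_right e Δ]
        ring
      rw [h2]
      have hs0 : 0 ≤ s := norm_nonneg _
      calc _ ≤ ‖e‖ * ‖p c' - p c - P (c' - c)‖ := real_inner_le_norm _ _
        _ ≤ ‖e‖ * (ε / M * ((1 + μ⁻¹) * s)) := by
            refine mul_le_mul_of_nonneg_left (h1.trans ?_) (norm_nonneg _)
            exact mul_le_mul_of_nonneg_left hd (by positivity)
        _ = (ε / M * s) * (‖e‖ * (1 + μ⁻¹)) := by ring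
        _ ≤ (ε / M * s) * M := by
            refine mul_le_mul_of_nonneg_left ?_ (by positivity)
            rw [hM]; linarith
        _ = ε * s := by field_simp
    have h0 := hN _ _ (hp c) (μ⁻¹ • Q) (e - Q)
      ⟨fun _ => _, fun _ => _, fun _ => hp c, tendsto_const_nhds, tendsto_const_nhds,
        fun _ => hreg⟩
    rw [inner_smul_right, inner_sub_left, real_inner_self_eq_norm_sq] at h0
    have h1 : 0 ≤ ⟪e, Q⟫ - ‖Q‖ ^ 2 := by
      rcases lt_or_ge (⟪e, Q⟫ - ‖Q‖ ^ 2) 0 with h | h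
      · have := mul_neg_of_pos_of_neg (inv_pos.2 hμ0) h
        linarith
      · exact h
    have h2 : ‖(2 : ℝ) • Q - e‖ ^ 2 ≤ ‖e‖ ^ 2 := by
      rw [norm_sub_sq_real, norm_smul, inner_smul_left, mul_pow, real_inner_comm]
      simp only [conj_trivial, Real.norm_ofNat]
      linarith
    have h3 := (pow_le_pow_iff_left₀ (norm_nonneg _) (norm_nonneg e) two_ne_zero).1 h2
    have h4 : ⟪((2 : ℝ) • P - ContinuousLinearMap.id ℝ (EuclideanSpace ℝ (Fin n))) d, e⟫ = ⟪(2 : ℝ) • Q - e, d⟫ := by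
      simp only [_root_.sub_apply, _root_.smul_apply,
        ContinuousLinearMap.id_apply, inner_sub_left, inner_smul_left, hadj]
      rw [real_inner_comm e (P d), real_inner_comm d e]
    rw [h4]
    refine (real_inner_le_norm _ _).trans ?_
    rw [mul_comm]
    exact mul_le_mul_of_nonneg_left h3 (norm_nonneg _)
  have hae : ∀ᵐ x : (EuclideanSpace ℝ (Fin n)), ∀ d e : (EuclideanSpace ℝ (Fin n)),
      ⟪fderiv ℝ (fun c => (2 : ℝ) • p c - c) x d, e⟫ ≤ ‖d‖ * ‖e‖ :=
    (hlip.ae_differentiableAt (μ := (volume : Measure (EuclideanSpace ℝ (Fin n))))).mono hpt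
  have h1 := lip_of_ae _ _ hlipF hae c' (c - c')
    ((2 : ℝ) • p c - c - ((2 : ℝ) • p c' - c'))
  rw [add_sub_cancel, real_inner_self_eq_norm_sq] at h1
  have e : (2 : ℝ) • p c - c - ((2 : ℝ) • p c' - c') = (2 : ℝ) • (p c - p c') - (c - c') := by
    module
  rw [e] at h1
  have h2 : ‖(2 : ℝ) • (p c - p c') - (c - c')‖ ^ 2 ≤ ‖c - c'‖ ^ 2 := by
    nlinarith [sq_nonneg (‖(2 : ℝ) • (p c - p c') - (c - c')‖ - ‖c - c'‖)]
  rw [norm_sub_sq_real, norm_smul, inner_smul_left, mul_pow] at h2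
  simp only [conj_trivial, Real.norm_ofNat] at h2
  linarith

/-- Convexity inequality for the envelope. -/
lemma envelope_convex (ρ μ : ℝ) (φ : (EuclideanSpace ℝ (Fin n)) → EReal) (hb : ∀ x, φ x ≠ ⊥) (hρ : 0 ≤ ρ) (hμ : ρ < μ)
    (p : (EuclideanSpace ℝ (Fin n)) → (EuclideanSpace ℝ (Fin n))) (hp : ∀ c, (p c, μ • (c - p c)) ∈ gphSubdiff ρ φ)
    (hf : ∀ c c', ‖p c - p c'‖ ^ 2 ≤ ⟪p c - p c', c - c'⟫)
    (x y : (EuclideanSpace ℝ (Fin n))) (hx : φ x ≠ ⊤) (hy : φ y ≠ ⊤) (a b : ℝ) (ha : 0 ≤ a) (hb0 : 0 ≤ b)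
    (hab : a + b = 1) :
    (φ (p (a • x + b • y))).toReal + μ / 2 * ‖p (a • x + b • y) - (a • x + b • y)‖ ^ 2
      ≤ a * (φ x).toReal + b * (φ y).toReal := by
  have hμ0 : 0 < μ := by linarith
  set e : (EuclideanSpace ℝ (Fin n)) → ℝ := fun c => (φ (p c)).toReal + μ / 2 * ‖p c - c‖ ^ 2 with he
  -- minimality
  have hmin : ∀ c u, φ u ≠ ⊤ → e c ≤ (φ u).toReal + μ / 2 * ‖u - c‖ ^ 2 := by
    intro c u hu
    have h1 := ((mem_gph_iff ρ φ hb _ _).1 (hp c)).2 u hu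
    have h2 : u - c = (u - p c) + (p c - c) := by abel
    have h3 : ⟪μ • (c - p c), u - p c⟫ = - (μ * ⟪u - p c, p c - c⟫) := by
      rw [inner_smul_left, real_inner_comm, ← neg_sub (p c) c, inner_neg_right]; simp
    rw [h2, norm_add_sq_real]
    rw [h3] at h1
    have h4 : ρ / 2 * ‖u - p c‖ ^ 2 ≤ μ / 2 * ‖u - p c‖ ^ 2 :=
      mul_le_mul_of_nonneg_right (by linarith) (by positivity)
    simp only [he]
    linarith
  -- descent
  have hdesc : ∀ c c', e c' ≤ e c + μ * ⟪c - p c, c' - c⟫ + μ / 2 * ‖c' - c‖ ^ 2 := by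
    intro c c'
    have h1 := hmin c' (p c) ((mem_gph_iff ρ φ hb _ _).1 (hp c)).1
    have h2 : p c - c' = (p c - c) - (c' - c) := by abel
    rw [h2, norm_sub_sq_real] at h1
    have h3 : ⟪c - p c, c' - c⟫ = - ⟪p c - c, c' - c⟫ := by
      rw [← neg_sub, inner_neg_left]
    rw [h3]
    simp only [he] at h1 ⊢
    linarith
  -- monotone gradient
  have hmono : ∀ c c', 0 ≤ ⟪(c' - p c') - (c - p c), c' - c⟫ := by
    intro c c'
    have h1 := hf c' c
    have h2 : (c' - p c') - (c - p c) = (c' - c) - (p c' - p c) := by abel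
    rw [h2, inner_sub_left, real_inner_self_eq_norm_sq]
    have h3 := real_inner_le_norm (p c' - p c) (c' - c)
    have h4 := sq_nonneg ‖(c' - c) - (p c' - p c)‖
    rw [norm_sub_sq_real, real_inner_comm] at h4
    linarith
  -- subgradient inequality
  have hsub : ∀ c c', e c + μ * ⟪c - p c, c' - c⟫ ≤ e c' := by
    intro c c'
    set d := c' - c with hd
    have hN : ∀ N : ℕ, e c + μ * ⟪c - p c, d⟫ ≤ e c' + (μ / 2 * ‖d‖ ^ 2) * (1 / ((N : ℝ) + 1)) := by
      intro N
      set h : ℝ := 1 / ((N : ℝ) + 1) with hh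
      have hh0 : 0 < h := by positivity
      have hi : ∀ i : ℕ, e c + (i * h) * (μ * ⟪c - p c, d⟫)
          ≤ e (c + (i * h) • d) + i * (μ / 2 * (h ^ 2 * ‖d‖ ^ 2)) := by
        intro i
        induction i with
        | zero => simp
        | succ i ih =>
          push_cast
          set ci := c + ((i : ℝ) * h) • d with hci
          set cj := c + (((i : ℝ) + 1) * h) • d with hcj
          have h1 := hdesc cj ci
          have h2 : ci - cj = (-h) • d := by rw [hci, hcj]; module
          rw [h2, inner_smul_right, norm_smul, mul_pow, Real.norm_eq_abs, sq_abs] at h1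
          have h3 := hmono c cj
          have h4 : cj - c = (((i : ℝ) + 1) * h) • d := by rw [hcj]; module
          have h5 : 0 ≤ ⟪cj - p cj - (c - p c), d⟫ := by
            rw [show ⟪cj - p cj - (c - p c), cj - c⟫
              = (((i : ℝ) + 1) * h) * ⟪cj - p cj - (c - p c), d⟫ by
                rw [← inner_smul_right, ← h4]] at h3
            exact nonneg_of_mul_nonneg_right h3 (by positivity)
          rw [inner_sub_left] at h5
          have h6 := mul_nonneg (mul_nonneg hμ0.le hh0.le) h5
          nlinarith
      have := hi (N + 1)
      push_cast at this
      have h7 : ((N : ℝ) + 1) * h = 1 := by rw [hh]; field_simp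
      rw [h7, one_mul, one_smul, hd, add_sub_cancel, ← hd] at this
      have h8 : ((N : ℝ) + 1) * (μ / 2 * (h ^ 2 * ‖d‖ ^ 2)) = (((N : ℝ) + 1) * h) * (μ / 2 * ‖d‖ ^ 2 * h) := by
        ring
      rw [h8, h7, one_mul] at this
      exact this
    have hlim : Tendsto (fun N : ℕ => e c' + (μ / 2 * ‖d‖ ^ 2) * (1 / ((N : ℝ) + 1))) atTop
        (𝓝 (e c' + (μ / 2 * ‖d‖ ^ 2) * 0)) :=
      (tendsto_one_div_add_atTop_nhds_zero_nat.const_mul _).const_add _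
    rw [mul_zero, add_zero] at hlim
    exact ge_of_tendsto' hlim hN
  set c := a • x + b • y with hc
  have hx1 := (hsub c x).trans (hmin x x hx)
  have hy1 := (hsub c y).trans (hmin y y hy)
  simp only [sub_self, norm_zero, ne_eq, OfNat.ofNat_ne_zero, not_false_eq_true, zero_pow,
    mul_zero, add_zero] at hx1 hy1
  have h0 : a * ⟪c - p c, x - c⟫ + b * ⟪c - p c, y - c⟫ = 0 := by
    rw [← inner_smul_right, ← inner_smul_right, ← inner_add_right]
    have : a • (x - c) + b • (y - c) = 0 := by
      have hb' : b = 1 - a := by linarith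
      rw [hc, hb']; module
    rw [this, inner_zero_right]
  have hx2 := mul_le_mul_of_nonneg_left hx1 ha
  have hy2 := mul_le_mul_of_nonneg_left hy1 hb0
  have h9 : e c = a * e c + b * e c := by rw [← add_mul, hab, one_mul]
  change e c ≤ _
  rw [h9]
  have h10 : a * (μ * ⟪c - p c, x - c⟫) + b * (μ * ⟪c - p c, y - c⟫) = 0 := by
    calc _ = μ * (a * ⟪c - p c, x - c⟫ + b * ⟪c - p c, y - c⟫) := by ring
      _ = 0 := by rw [h0, mul_zero]
  linarith

lemma convex_of (ρ : ℝ) (φ : (EuclideanSpace ℝ (Fin n)) → EReal) (hb : ∀ x, φ x ≠ ⊥) (hprop : ∃ x, φ x ≠ ⊤)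
    (hl : LowerSemicontinuous φ) (hρ : 0 ≤ ρ) (hconv : ERealConvex (shiftFun ρ φ))
    (hN : ∀ x y : (EuclideanSpace ℝ (Fin n)), (x, y) ∈ gphSubdiff ρ φ → ∀ w z : (EuclideanSpace ℝ (Fin n)),
      (z, -w) ∈ limNormalCone (gphSubdiff ρ φ) (x, y) → 0 ≤ ⟪z, w⟫) : ERealConvex φ := by
  have hw := wcReal_of ρ φ hb hconv
  have hmulbot : ∀ (b : ℝ) (y : (EuclideanSpace ℝ (Fin n))), 0 ≤ b → (b : EReal) * φ y ≠ ⊥ := by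
    intro b y hb0 h
    by_cases hy : φ y = ⊤
    · rcases hb0.eq_or_lt with h0 | h0
      · rw [← h0] at h; simp at h
      · rw [hy, EReal.coe_mul_top_of_pos h0] at h; simp at h
    · rw [← EReal.coe_toReal hy (hb y), ← EReal.coe_mul] at h
      exact EReal.coe_ne_bot _ h
  intro x y a b ha hb0 hab
  rcases ha.eq_or_lt with rfl | ha'
  · obtain rfl : b = 1 := by linarith
    simp
  rcases hb0.eq_or_lt with rfl | hb'
  · obtain rfl : a = 1 := by linarith
    simp
  by_cases hx : φ x = ⊤
  · rw [hx, EReal.coe_mul_top_of_pos ha', EReal.top_add_of_ne_bot (hmulbot b y hb0)]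
    exact le_top
  by_cases hy : φ y = ⊤
  · rw [hy, EReal.coe_mul_top_of_pos hb', EReal.add_top_of_ne_bot (hmulbot a x ha)]
    exact le_top
  set c := a • x + b • y with hc
  have hcD := (hw x y hx hy a b ha hb0 hab).1
  rw [← hc] at hcD
  obtain ⟨A, hA, hg⟩ := growth ρ φ hb hl hw c hcD hρ
  set M := a * (φ x).toReal + b * (φ y).toReal with hM
  have hMe : (a : EReal) * φ x + (b : EReal) * φ y = (M : EReal) := by
    rw [hM, EReal.coe_add, EReal.coe_mul, EReal.coe_mul, EReal.coe_toReal hx (hb x),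
      EReal.coe_toReal hy (hb y)]
  rw [hMe]
  by_contra hcon
  push Not at hcon
  obtain ⟨δ, hδ, hball⟩ := Metric.eventually_nhds_iff.1 (hl c _ hcon)
  set K := (|M| + A) / δ ^ 2 + A / δ + 1 with hK
  have hK0 : 0 < K := by positivity
  set μ := ρ + 2 * K with hμd
  have hμ : ρ < μ := by linarith
  obtain ⟨p, hp⟩ := exists_prox ρ μ φ hb hl hw hprop hρ hμ
  have hf := prox_firm ρ μ φ hb hρ hμ p hp hN
  have h1 := envelope_convex ρ μ φ hb hρ hμ p hp hf x y hx hy a b ha hb0 hab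
  rw [← hc, ← hM] at h1
  have hpD := ((mem_gph_iff ρ φ hb _ _).1 (hp c)).1
  have h2 := hg _ hpD
  set r := ‖p c - c‖ with hr
  have hrδ : δ ≤ r := by
    by_contra hlt
    push Not at hlt
    have h3 : (M : EReal) < φ (p c) := hball (y := p c) (by rwa [dist_eq_norm])
    rw [← EReal.coe_toReal hpD (hb _), EReal.coe_lt_coe_iff] at h3
    have : 0 ≤ μ / 2 * r ^ 2 := by
      have : 0 ≤ μ := by linarith
      positivity
    linarith
  have hr0 : 0 < r := by linarith
  have h4 : K * r ^ 2 ≤ M + A + A * r := by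
    have : μ / 2 * r ^ 2 = ρ / 2 * r ^ 2 + K * r ^ 2 := by rw [hμd]; ring
    linarith
  have h5 : |M| + A ≤ (|M| + A) / δ ^ 2 * r ^ 2 := by
    rw [div_mul_eq_mul_div, le_div_iff₀ (by positivity)]
    exact mul_le_mul_of_nonneg_left (pow_le_pow_left₀ hδ.le hrδ 2) (by positivity)
  have h6 : A * r ≤ A / δ * r ^ 2 := by
    rw [div_mul_eq_mul_div, le_div_iff₀ hδ, mul_assoc]
    refine mul_le_mul_of_nonneg_left ?_ hA
    rw [sq]
    exact mul_le_mul_of_nonneg_left hrδ hr0.le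
  have h7 : K * r ^ 2 = (|M| + A) / δ ^ 2 * r ^ 2 + A / δ * r ^ 2 + r ^ 2 := by rw [hK]; ring
  have h8 := le_abs_self M
  have h9 : 0 < r ^ 2 := by positivity
  linarith

end Helpers

/-- convexity characterized via the limiting second-order
subdifferential (limiting normal cone to the graph of the subdifferential). -/
theorem statement13 (n : ℕ) (φ : EuclideanSpace ℝ (Fin n) → EReal)
    (hnotbot : ∀ x, φ x ≠ ⊥) (hproper : ∃ x, φ x ≠ ⊤)
    (hlsc : LowerSemicontinuous φ) :
    ERealConvex φ ↔
      ∃ ρ : ℝ, 0 ≤ ρ ∧ ERealConvex (shiftFun ρ φ) ∧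
        ∀ x y : EuclideanSpace ℝ (Fin n), (x, y) ∈ gphSubdiff ρ φ →
          ∀ w z : EuclideanSpace ℝ (Fin n),
            (z, -w) ∈ limNormalCone (gphSubdiff ρ φ) (x, y) → 0 ≤ ⟪z, w⟫ := by
  constructor
  · intro hconv
    have h0 : shiftFun 0 φ = φ := by
      funext x; simp [shiftFun]
    have hconv' : ERealConvex (shiftFun 0 φ) := by rwa [h0]
    refine ⟨0, le_rfl, hconv', ?_⟩
    obtain ⟨p, hp⟩ := exists_prox 0 1 φ hnotbot hlsc (wcReal_of 0 φ hnotbot hconv') hproper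
      le_rfl one_pos
    intro x y _ w z h
    exact lim_nonneg φ hnotbot p hp (x, y) z w h
  · rintro ⟨ρ, hρ, hconv, hN⟩
    exact convex_of ρ φ hnotbot hproper hlsc hρ hconv hN

end
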